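/- Let γ ∈ (0,1], T > 0. Let b ∈ L^∞([0,T]; C^1_b(ℝ^d;ℝ^d)), c ∈ L^∞([0,T]; C^1_b(ℝ^d;ℝ)), let X, Y ∈ C^γ([0,T];ℝ^d) with X_0 = Y_0 = 0, let Φ^X, Φ^Y be the unique flows of Φ_t(x) = x + ∫_0^t b_r(Φ_r(x)) dr + X_t (respectively with Y), and define K^X_t(x) := exp(∫_0^t c_q(Φ^X_q(x)) dq) and K^Y_t(x) analogously. Then: (i) there is a constant C, depending only on T, sup_t‖Db_t‖_∞, sup_t‖c_t‖_∞ and sup_t‖∇c_t‖_∞ and nondecreasing in each, such that for all x ∈ ℝ^d, sup_{s≠t∈[0,T]} |(K^X_t(x) − K^Y_t(x)) − (K^X_s(x) − K^Y_s(x))|/|t−s| ≤ C ‖X−Y‖_γ (and K^X_0(x) = K^Y_0(x) = 1); (ii) if moreover b ∈ L^∞([0,T];C^2_b) and c ∈ L^∞([0,T];C^2_b), then there is a constant C', depending additionally on sup_t‖D²b_t‖_∞ and sup_t‖D²c_t‖_∞, such that for all x: sup_{s≠t∈[0,T]} |(∇K^X_t(x) − ∇K^Y_t(x)) − (∇K^X_s(x)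 − ∇K^Y_s(x))|/|t−s| + |∇K^X_0(x) − ∇K^Y_0(x)| ≤ C' ‖X−Y‖_γ. -/

import Mathlib

open MeasureTheory Set Function

noncomputable section

abbrev Euc (d : ℕ) : Type := EuclideanSpace ℝ (Fin d)

/-- A bounded function that is a.e. strongly measurable on `[0, T]` is interval integrable between
any two points of `[0, T]`. -/
theorem intervalIntegrable_of_bdd {F : Type*} [NormedAddCommGroup F] {T C : ℝ} {f : ℝ → F}
    (hf : AEStronglyMeasurable f (volume.restrict (Icc 0 T)))
    (hC : ∀ r ∈ Icc (0:ℝ) T, ‖f r‖ ≤ C) {s t : ℝ} (hs : s ∈ Icc (0:ℝ) T)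
    (ht : t ∈ Icc (0:ℝ) T) : IntervalIntegrable f volume s t := by
  have h : IntegrableOn f (Icc 0 T) volume :=
    Integrable.of_bound hf C
      ((ae_restrict_iff' measurableSet_Icc).2 (Filter.Eventually.of_forall hC))
  exact (h.mono_set ((uIcc_subset_Icc hs ht))).intervalIntegrable

theorem mem_Icc_of_mem_uIoc {T s t r : ℝ} (hs : s ∈ Icc (0:ℝ) T) (ht : t ∈ Icc (0:ℝ) T)
    (hr : r ∈ uIoc s t) : r ∈ Icc (0:ℝ) T :=
  uIcc_subset_Icc hs ht (uIoc_subset_uIcc hr)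

theorem norm_integral_le_of_bdd {F : Type*} [NormedAddCommGroup F] [NormedSpace ℝ F] {T C : ℝ}
    {f : ℝ → F} (hC : ∀ r ∈ Icc (0:ℝ) T, ‖f r‖ ≤ C) {s t : ℝ} (hs : s ∈ Icc (0:ℝ) T)
    (ht : t ∈ Icc (0:ℝ) T) : ‖∫ r in s..t, f r‖ ≤ C * |t - s| :=
  intervalIntegral.norm_integral_le_of_norm_le_const fun _ hr => hC _ (mem_Icc_of_mem_uIoc hs ht hr)

/-- Composition of a jointly measurable map with a continuous path is measurable on `[0, T]`. -/
theorem aestronglyMeasurable_comp_path {E F : Type*} [TopologicalSpace E] [MeasurableSpace E]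
    [BorelSpace E] [TopologicalSpace.PseudoMetrizableSpace E]
    [TopologicalSpace F] [MeasurableSpace F] [BorelSpace F]
    [TopologicalSpace.PseudoMetrizableSpace F] [SecondCountableTopology F] {T : ℝ}
    {g : ℝ → E → F} (hg : Measurable (uncurry g)) {φ : ℝ → E} (hφ : ContinuousOn φ (Icc 0 T)) :
    AEStronglyMeasurable (fun r => g r (φ r)) (volume.restrict (Icc 0 T)) :=
  (hg.comp_aemeasurable
    (aemeasurable_id.prodMk (hφ.aemeasurable measurableSet_Icc))).aestronglyMeasurable

/-- Integral form of Grönwall's inequality. -/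
theorem norm_le_of_norm_le_integral {F G : Type*} [NormedAddCommGroup F] [NormedAddCommGroup G]
    [NormedSpace ℝ G] {T M N a : ℝ} (ha : 0 ≤ a) (hN : 0 ≤ N) {v : ℝ → F} {f : ℝ → G}
    (hv : ContinuousOn v (Icc 0 T))
    (hvf : ∀ t ∈ Icc (0:ℝ) T, ‖v t‖ ≤ M + ‖∫ r in (0:ℝ)..t, f r‖)
    (hf : ∀ r ∈ Icc (0:ℝ) T, ‖f r‖ ≤ a * ‖v r‖ + N) :
    ∀ t ∈ Icc (0:ℝ) T, ‖v t‖ ≤ (M + N * T) * Real.exp (a * T) := by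
  intro t ht
  have hT : 0 ≤ T := ht.1.trans ht.2
  set w : ℝ → ℝ := fun r => ‖v (projIcc 0 T hT r)‖ with hw
  have hwc : Continuous w := by
    have : Continuous (IccExtend hT ((Icc 0 T).domRestrict v)) :=
      (continuousOn_iff_continuous_domRestrict.1 hv).Icc_extend'
    exact this.norm
  have hwv : ∀ r ∈ Icc (0:ℝ) T, w r = ‖v r‖ := fun r hr => by
    simp only [hw, projIcc_of_mem hT hr]
  have hw0 : ∀ r, 0 ≤ w r := fun r => norm_nonneg _
  set K := M + N * T with hK
  have hmain : ∀ r ∈ Icc (0:ℝ) T, w r ≤ K + a * ∫ q in (0:ℝ)..r, w q := by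
    intro r hr
    rw [hwv r hr]
    refine (hvf r hr).trans ?_
    have h1 : ‖∫ q in (0:ℝ)..r, f q‖ ≤ ∫ q in (0:ℝ)..r, (a * w q + N) := by
      refine intervalIntegral.norm_integral_le_of_norm_le hr.1 ?_
        (((hwc.const_mul a).add continuous_const).intervalIntegrable _ _)
      refine Filter.Eventually.of_forall fun q hq => ?_
      have hq' : q ∈ Icc (0:ℝ) T := ⟨hq.1.le, hq.2.trans hr.2⟩
      rw [hwv q hq']; exact hf q hq'
    rw [intervalIntegral.integral_add ((hwc.const_mul a).intervalIntegrable _ _)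
      (continuous_const.intervalIntegrable _ _), intervalIntegral.integral_const_mul,
      intervalIntegral.integral_const] at h1
    have h2 : N * r ≤ N * T := mul_le_mul_of_nonneg_left hr.2 hN
    simp only [sub_zero, smul_eq_mul] at h1
    rw [hK]; linarith
  have hK0 : 0 ≤ K := by simpa using (hw0 0).trans (hmain 0 ⟨le_rfl, hT⟩)
  have hU0 : ∀ r, 0 ≤ r → 0 ≤ ∫ q in (0:ℝ)..r, w q := fun r hr =>
    intervalIntegral.integral_nonneg hr fun q _ => hw0 q
  have hg := norm_le_gronwallBound_of_norm_deriv_right_le (f := fun r => ∫ q in (0:ℝ)..r, w q)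
    (f' := w) (δ := 0) (K := a) (ε := K) (a := 0) (b := T)
    (intervalIntegral.continuous_primitive (fun _ _ => hwc.intervalIntegrable _ _) 0).continuousOn
    (fun r _ => (hwc.integral_hasStrictDerivAt 0 r).hasDerivAt.hasDerivWithinAt) (by simp)
    (fun r hr => by
      rw [Real.norm_of_nonneg (hw0 r), Real.norm_of_nonneg (hU0 r hr.1)]
      linarith [hmain r ⟨hr.1, hr.2.le⟩]) t ht
  rw [Real.norm_of_nonneg (hU0 t ht.1), sub_zero] at hg
  have h3 : w t ≤ K * Real.exp (a * t) := by
    refine (hmain t ht).trans ?_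
    have := mul_le_mul_of_nonneg_left hg ha
    rcases eq_or_ne a 0 with h0 | h0
    · simp [h0]
    · rw [gronwallBound_of_K_ne_0 h0] at this
      have h4 : a * (0 * Real.exp (a * t) + K / a * (Real.exp (a * t) - 1)) =
        K * Real.exp (a * t) - K := by field_simp; ring
      linarith
  rw [← hwv t ht]
  refine h3.trans ?_
  have := ht.2
  gcongr

/-- Existence for linear differential equations with bounded measurable coefficients. -/
theorem exists_linear_integral_eq {R : Type*} [NormedRing R] [NormedAlgebra ℝ R] [CompleteSpace R]
    {T a : ℝ} (ha : 0 ≤ a) {A : ℝ → R}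
    (hA : AEStronglyMeasurable A (volume.restrict (Icc 0 T)))
    (hAa : ∀ r ∈ Icc (0:ℝ) T, ‖A r‖ ≤ a) :
    ∃ J : ℝ → R, ContinuousOn J (Icc 0 T) ∧
      ∀ t ∈ Icc (0:ℝ) T, J t = 1 + ∫ r in (0:ℝ)..t, A r * J r := by
  rcases lt_or_ge T 0 with hT | hT
  · exact ⟨0, continuousOn_const, fun t ht => absurd (ht.1.trans ht.2) hT.not_ge⟩
  let P : ℕ → ℝ → R := fun n => Nat.rec (fun _ => 1) (fun _ p t => ∫ r in (0:ℝ)..t, A r * p r) n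
  have hP0 : ∀ t, P 0 t = 1 := fun _ => rfl
  have hPs : ∀ n t, P (n + 1) t = ∫ r in (0:ℝ)..t, A r * P n r := fun _ _ => rfl
  have h0T : (0:ℝ) ∈ Icc (0:ℝ) T := ⟨le_rfl, hT⟩
  have hTT : T ∈ Icc (0:ℝ) T := ⟨hT, le_rfl⟩
  have hcm : ∀ n, ContinuousOn (P n) (Icc 0 T) →
      AEStronglyMeasurable (fun r => A r * P n r) (volume.restrict (Icc 0 T)) := fun n h =>
    hA.mul (h.aestronglyMeasurable_of_isCompact isCompact_Icc measurableSet_Icc)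
  have key : ∀ n, ContinuousOn (P n) (Icc 0 T) ∧
      ∀ t ∈ Icc (0:ℝ) T, ‖P n t‖ ≤ ‖(1:R)‖ * ((a * t) ^ n / n.factorial) := by
    intro n
    induction n with
    | zero => exact ⟨continuousOn_const, fun t _ => by simp [hP0]⟩
    | succ n ih =>
      have hb : ∀ r ∈ Icc (0:ℝ) T,
          ‖A r * P n r‖ ≤ a * (‖(1:R)‖ * ((a * r) ^ n / n.factorial)) := fun r hr =>
        (norm_mul_le _ _).trans (mul_le_mul (hAa r hr) (ih.2 r hr) (norm_nonneg _) ha)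
      have hb' : ∀ r ∈ Icc (0:ℝ) T,
          ‖A r * P n r‖ ≤ a * (‖(1:R)‖ * ((a * T) ^ n / n.factorial)) := fun r hr => by
        have h1 := hr.1
        have h2 := hr.2
        refine (hb r hr).trans ?_
        gcongr
      constructor
      · have := intervalIntegral.continuousOn_primitive_interval'
          (intervalIntegrable_of_bdd (hcm n ih.1) hb' h0T hTT) left_mem_uIcc
        rwa [uIcc_of_le hT] at this
      · intro t ht
        rw [hPs]
        refine (intervalIntegral.norm_integral_le_of_norm_le
          (g := fun r => a * (‖(1:R)‖ * ((a * r) ^ n / n.factorial))) ht.1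
          (Filter.Eventually.of_forall fun q hq => hb q ⟨hq.1.le, hq.2.trans ht.2⟩)
          (Continuous.intervalIntegrable (by fun_prop) _ _)).trans (le_of_eq ?_)
        simp only [mul_pow, intervalIntegral.integral_const_mul, intervalIntegral.integral_div,
          integral_pow, Nat.factorial_succ]
        push_cast
        field_simp
        ring
  have hbd : ∀ n, ∀ t ∈ Icc (0:ℝ) T, ‖P n t‖ ≤ ‖(1:R)‖ * ((a * T) ^ n / n.factorial) :=
    fun n t ht => ((key n).2 t ht).trans (by
      have h1 := ht.1
      have h2 := ht.2
      gcongr)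
  have hsum : Summable fun n : ℕ => ‖(1:R)‖ * ((a * T) ^ n / n.factorial) :=
    (Real.summable_pow_div_factorial (a * T)).mul_left _
  refine ⟨fun t => ∑' n, P n t, continuousOn_tsum (fun n => (key n).1) hsum hbd, fun t ht => ?_⟩
  have hS : ∀ r ∈ Icc (0:ℝ) T, Summable fun n => P n r := fun r hr =>
    Summable.of_norm_bounded hsum fun n => hbd n r hr
  have hint : HasSum (fun n => ∫ r in (0:ℝ)..t, A r * P n r)
      (∫ r in (0:ℝ)..t, A r * ∑' n, P n r) := by
    refine intervalIntegral.hasSum_integral_of_dominated_convergence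
      (fun n _ => a * (‖(1:R)‖ * ((a * T) ^ n / n.factorial))) (fun n => ?_) (fun n => ?_) ?_ ?_ ?_
    · exact (hcm n (key n).1).mono_set
        (uIoc_subset_uIcc.trans (uIcc_subset_Icc h0T ht))
    · refine Filter.Eventually.of_forall fun r hr => ?_
      have hr' := mem_Icc_of_mem_uIoc h0T ht hr
      exact (norm_mul_le _ _).trans (mul_le_mul (hAa r hr') (hbd n r hr') (norm_nonneg _) ha)
    · exact Filter.Eventually.of_forall fun r _ => hsum.mul_left a
    · exact intervalIntegrable_const
    · exact Filter.Eventually.of_forall fun r hr =>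
        (hS r (mem_Icc_of_mem_uIoc h0T ht hr)).hasSum.mul_left _
  simp only
  rw [(hS t ht).tsum_eq_zero_add, hP0, ← hint.tsum_eq]

/-- A family of continuous linear maps on a finite-dimensional space is a.e. strongly measurable
as soon as it is so pointwise. -/
theorem aestronglyMeasurable_clm_of_apply {α E F : Type*} [MeasurableSpace α] {μ : Measure α}
    [NormedAddCommGroup E] [NormedSpace ℝ E] [FiniteDimensional ℝ E]
    [NormedAddCommGroup F] [NormedSpace ℝ F] {A : α → E →L[ℝ] F}
    (hA : ∀ v, AEStronglyMeasurable (fun r => A r v) μ) : AEStronglyMeasurable A μ := by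
  let e := Module.finBasis ℝ E
  have h : A = fun r => ∑ i, ContinuousLinearMap.smulRightL ℝ E F
      (LinearMap.toContinuousLinearMap (e.coord i)) (A r (e i)) := by
    funext r
    ext v
    conv_lhs => rw [← e.sum_repr v]
    simp only [map_sum, map_smul, sum_apply]
    simp
  rw [h]
  exact Finset.aestronglyMeasurable_fun_sum _ fun i _ =>
    (ContinuousLinearMap.continuous _).comp_aestronglyMeasurable (hA _)

/-- The space derivative of a time-dependent map along a continuous path is measurable in time. -/
theorem aestronglyMeasurable_fderiv_path {E F : Type*} [NormedAddCommGroup E] [NormedSpace ℝ E]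
    [FiniteDimensional ℝ E] [MeasurableSpace E] [BorelSpace E]
    [NormedAddCommGroup F] [NormedSpace ℝ F] [MeasurableSpace F] [BorelSpace F]
    [SecondCountableTopology F] {T : ℝ} {g : ℝ → E → F} (hg : Measurable (uncurry g))
    (hd : ∀ t ∈ Icc (0:ℝ) T, Differentiable ℝ (g t)) {φ : ℝ → E}
    (hφ : ContinuousOn φ (Icc 0 T)) :
    AEStronglyMeasurable (fun r => fderiv ℝ (g r) (φ r)) (volume.restrict (Icc 0 T)) := by
  refine aestronglyMeasurable_clm_of_apply fun v => ?_
  refine aestronglyMeasurable_of_tendsto_ae Filter.atTop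
    (f := fun (n : ℕ) r => ((n:ℝ) + 1) • (g r (φ r + ((n:ℝ) + 1)⁻¹ • v) - g r (φ r)))
    (fun n => ?_) ?_
  · exact ((aestronglyMeasurable_comp_path hg (hφ.add continuousOn_const)).sub
      (aestronglyMeasurable_comp_path hg hφ)).const_smul _
  · refine (ae_restrict_iff' measurableSet_Icc).2 (Filter.Eventually.of_forall fun r hr => ?_)
    exact ((hd r hr (φ r)).hasFDerivAt.lim_real v).comp
      (Filter.tendsto_atTop_add_const_right _ _ tendsto_natCast_atTop_atTop)

/-- Second order Taylor estimate for a map whose derivative is Lipschitz. -/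
theorem norm_sub_sub_fderiv_le {E F : Type*} [NormedAddCommGroup E] [NormedSpace ℝ E]
    [NormedAddCommGroup F] [NormedSpace ℝ F] {f : E → F} {K : ℝ} (hK : 0 ≤ K)
    (hf : Differentiable ℝ f) (hL : ∀ x y, ‖fderiv ℝ f x - fderiv ℝ f y‖ ≤ K * ‖x - y‖) (x y : E) :
    ‖f y - f x - fderiv ℝ f x (y - x)‖ ≤ K * ‖y - x‖ ^ 2 := by
  have := (convex_closedBall x ‖y - x‖).norm_image_sub_le_of_norm_fderiv_le' (𝕜 := ℝ) (f := f)
    (φ := fderiv ℝ f x) (C := K * ‖y - x‖) (x := x) (y := y) (fun z _ => hf z) (fun z hz => ?_)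
    (by simp) (by simp [dist_eq_norm])
  · linarith
  · refine (hL z x).trans ?_
    rw [mem_closedBall_iff_norm] at hz
    gcongr

theorem norm_sub_le_of_fderiv_bound {E F : Type*} [NormedAddCommGroup E] [NormedSpace ℝ E]
    [NormedAddCommGroup F] [NormedSpace ℝ F] {f : E → F} {K : ℝ}
    (hf : Differentiable ℝ f) (hK : ∀ x, ‖fderiv ℝ f x‖ ≤ K) (x y : E) :
    ‖f x - f y‖ ≤ K * ‖x - y‖ :=
  convex_univ.norm_image_sub_le_of_norm_fderiv_le (𝕜 := ℝ) (fun z _ => hf z) (fun z _ => hK z)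
    (mem_univ _) (mem_univ _)

theorem norm_fderiv_sub_le_of_iteratedFDeriv_bound {E F : Type*} [NormedAddCommGroup E]
    [NormedSpace ℝ E] [NormedAddCommGroup F] [NormedSpace ℝ F] {f : E → F} {K : ℝ}
    (hf : ContDiff ℝ 2 f) (hK : ∀ x, ‖iteratedFDeriv ℝ 2 f x‖ ≤ K) (x y : E) :
    ‖fderiv ℝ f x - fderiv ℝ f y‖ ≤ K * ‖x - y‖ := by
  refine norm_sub_le_of_fderiv_bound
    ((hf.fderiv_right (m := 1) (by norm_num)).differentiable (by norm_num)) (fun z => ?_) x y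
  rw [← norm_iteratedFDeriv_one, norm_iteratedFDeriv_fderiv]
  exact hK z

/-- A quadratic remainder yields differentiability. -/
theorem hasFDerivAt_of_norm_le_sq {E F : Type*} [NormedAddCommGroup E] [NormedSpace ℝ E]
    [NormedAddCommGroup F] [NormedSpace ℝ F] {f : E → F} {f' : E →L[ℝ] F} {x : E} {C : ℝ}
    (h : ∀ y, ‖f y - f x - f' (y - x)‖ ≤ C * ‖y - x‖ ^ 2) : HasFDerivAt f f' x := by
  rw [hasFDerivAt_iff_isLittleO]
  refine (Asymptotics.IsBigO.of_bound C (Filter.Eventually.of_forall fun y => ?_)).trans_isLittleO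
    ((Asymptotics.isLittleO_norm_pow_id one_lt_two).comp_tendsto
      (k := fun y => y - x) (l' := nhds x) ?_)
  · simpa using h y
  · simpa using (continuous_id.sub continuous_const).tendsto (x := x) (f := fun y => y - x)

/-- Time-dependent maps, jointly measurable, differentiable in space, with values bounded by `C`
and space derivatives bounded by `K` on the time interval `[0, T]`. -/
structure IsBddField {E F : Type*} [NormedAddCommGroup E] [NormedSpace ℝ E] [MeasurableSpace E]
    [NormedAddCommGroup F] [NormedSpace ℝ F] [MeasurableSpace F]
    (T : ℝ) (b : ℝ → E → F) (C K : ℝ) : Prop where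
  measurable : Measurable (uncurry b)
  differentiable : ∀ t ∈ Icc (0:ℝ) T, Differentiable ℝ (b t)
  norm_le : ∀ t ∈ Icc (0:ℝ) T, ∀ x, ‖b t x‖ ≤ C
  norm_fderiv_le : ∀ t ∈ Icc (0:ℝ) T, ∀ x, ‖fderiv ℝ (b t) x‖ ≤ K

/-- The space derivatives of the time-dependent map are `L`-Lipschitz on `[0, T]`. -/
def HasLipschitzFDeriv {E F : Type*} [NormedAddCommGroup E] [NormedSpace ℝ E]
    [NormedAddCommGroup F] [NormedSpace ℝ F] (T : ℝ) (b : ℝ → E → F) (L : ℝ) : Prop :=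
  ∀ t ∈ Icc (0:ℝ) T, ∀ x y, ‖fderiv ℝ (b t) x - fderiv ℝ (b t) y‖ ≤ L * ‖x - y‖

/-- `φ` solves the ODE with vector field `b`, perturbed by `X`, started at `x`. -/
def IsSolution {E : Type*} [NormedAddCommGroup E] [NormedSpace ℝ E] (T : ℝ) (b : ℝ → E → E)
    (X : ℝ → E) (x : E) (φ : ℝ → E) : Prop :=
  ContinuousOn φ (Icc 0 T) ∧ ∀ t ∈ Icc (0:ℝ) T, φ t = x + (∫ r in (0:ℝ)..t, b r (φ r)) + X t

/-- `J` solves the linearization of the ODE with vector field `b` along the path `φ`. -/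
def IsLinearizedSolution {E : Type*} [NormedAddCommGroup E] [NormedSpace ℝ E] (T : ℝ)
    (b : ℝ → E → E) (φ : ℝ → E) (J : ℝ → E →L[ℝ] E) : Prop :=
  ContinuousOn J (Icc 0 T) ∧
    ∀ t ∈ Icc (0:ℝ) T, J t = 1 + ∫ r in (0:ℝ)..t, fderiv ℝ (b r) (φ r) * J r

theorem norm_sub_sub_fderiv_apply_le {E : Type*} [NormedAddCommGroup E] [NormedSpace ℝ E]
    {F : Type*} [NormedAddCommGroup F]
    [NormedSpace ℝ F] {K : ℝ} {f : E → F} {L : ℝ} (hL0 : 0 ≤ L)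
    (hf : Differentiable ℝ f) (hL : ∀ x y, ‖fderiv ℝ f x - fderiv ℝ f y‖ ≤ L * ‖x - y‖)
    (hK : ∀ x, ‖fderiv ℝ f x‖ ≤ K) (x y w : E) :
    ‖f y - f x - fderiv ℝ f x w‖ ≤ K * ‖y - x - w‖ + L * ‖y - x‖ ^ 2 := by
  have e : f y - f x - fderiv ℝ f x w =
      fderiv ℝ f x (y - x - w) + (f y - f x - fderiv ℝ f x (y - x)) := by
    simp only [map_sub]; abel
  rw [e]
  exact (norm_add_le _ _).trans (add_le_add ((fderiv ℝ f x).le_of_opNorm_le (hK x) _)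
    (norm_sub_sub_fderiv_le hL0 hf hL x y))

theorem norm_comp_sub_comp_le {E : Type*} [NormedAddCommGroup E] [NormedSpace ℝ E]
    {F : Type*} [NormedAddCommGroup F]
    [NormedSpace ℝ F] {K : ℝ} {A B : E →L[ℝ] F} {G H : E →L[ℝ] E} {ε R : ℝ} (hA : ‖A‖ ≤ K)
    (hAB : ‖A - B‖ ≤ ε) (hH : ‖H‖ ≤ R) :
    ‖A.comp G - B.comp H‖ ≤ K * ‖G - H‖ + ε * R := by
  have e : A.comp G - B.comp H = A.comp (G - H) + (A - B).comp H := by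
    ext v; simp
  rw [e]
  refine (norm_add_le _ _).trans (add_le_add ?_ ?_)
  · exact (ContinuousLinearMap.opNorm_comp_le _ _).trans (by gcongr)
  · exact (ContinuousLinearMap.opNorm_comp_le _ _).trans
      (mul_le_mul hAB hH (norm_nonneg _) ((norm_nonneg _).trans hAB))

theorem IsBddField.norm_sub_le {E : Type*} [NormedAddCommGroup E] [NormedSpace ℝ E]
    [MeasurableSpace E] {F : Type*} [NormedAddCommGroup F]
    [NormedSpace ℝ F] [MeasurableSpace F] {T C K : ℝ} {b : ℝ → E → F} (hb : IsBddField T b C K) {t : ℝ}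
    (ht : t ∈ Icc (0:ℝ) T) (x y : E) : ‖b t x - b t y‖ ≤ K * ‖x - y‖ :=
  norm_sub_le_of_fderiv_bound (hb.differentiable t ht) (hb.norm_fderiv_le t ht) x y

theorem IsBddField.intervalIntegrable {E : Type*} [NormedAddCommGroup E] [NormedSpace ℝ E]
    [MeasurableSpace E] [BorelSpace E] {F : Type*} [NormedAddCommGroup F]
    [NormedSpace ℝ F] [FiniteDimensional ℝ F]
    [MeasurableSpace F] [BorelSpace F] {T C K : ℝ} {b : ℝ → E → F} (hb : IsBddField T b C K) {φ : ℝ → E}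
    (hφ : ContinuousOn φ (Icc 0 T)) {s t : ℝ} (hs : s ∈ Icc (0:ℝ) T) (ht : t ∈ Icc (0:ℝ) T) :
    IntervalIntegrable (fun r => b r (φ r)) volume s t := by
  have := FiniteDimensional.proper_real F
  exact intervalIntegrable_of_bdd (aestronglyMeasurable_comp_path hb.measurable hφ)
    (fun r hr => hb.norm_le r hr _) hs ht

theorem IsLinearizedSolution.norm_le {E : Type*} [NormedAddCommGroup E] [NormedSpace ℝ E]
    [MeasurableSpace E] {T C a : ℝ} {b : ℝ → E → E} (hb : IsBddField T b C a) (ha : 0 ≤ a)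
    {φ : ℝ → E} {J : ℝ → E →L[ℝ] E} (hJ : IsLinearizedSolution T b φ J) :
    ∀ t ∈ Icc (0:ℝ) T, ‖J t‖ ≤ Real.exp (a * T) := by
  have h := norm_le_of_norm_le_integral (M := 1) (N := 0) ha le_rfl (v := J)
    (f := fun r => fderiv ℝ (b r) (φ r) * J r) hJ.1 (fun t ht => ?_)
    (fun r hr => ?_)
  · simpa using h
  · rw [hJ.2 t ht]
    exact (norm_add_le _ _).trans (by gcongr; exact ContinuousLinearMap.norm_id_le)
  · rw [add_zero]
    exact (norm_mul_le _ _).trans (by gcongr; exact hb.norm_fderiv_le r hr _)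

section Fields

variable {E F : Type*} [NormedAddCommGroup E] [NormedSpace ℝ E] [FiniteDimensional ℝ E]
  [MeasurableSpace E] [BorelSpace E] [NormedAddCommGroup F] [NormedSpace ℝ F]
  [FiniteDimensional ℝ F] [MeasurableSpace F] [BorelSpace F] {T C K a : ℝ}

theorem IsBddField.aestronglyMeasurable_fderiv {b : ℝ → E → F} (hb : IsBddField T b C K)
    {φ : ℝ → E} (hφ : ContinuousOn φ (Icc 0 T)) :
    AEStronglyMeasurable (fun r => fderiv ℝ (b r) (φ r)) (volume.restrict (Icc 0 T)) := by
  have := FiniteDimensional.proper_real F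
  exact aestronglyMeasurable_fderiv_path hb.measurable hb.differentiable hφ

theorem IsBddField.intervalIntegrable_fderiv_comp {b : ℝ → E → F} (hb : IsBddField T b C K)
    {φ : ℝ → E} (hφ : ContinuousOn φ (Icc 0 T)) {J : ℝ → E →L[ℝ] E}
    (hJ : ContinuousOn J (Icc 0 T)) {s t : ℝ}
    (hs : s ∈ Icc (0:ℝ) T) (ht : t ∈ Icc (0:ℝ) T) :
    IntervalIntegrable (fun r => (fderiv ℝ (b r) (φ r)).comp (J r)) volume s t := by
  have hJm : AEStronglyMeasurable J (volume.restrict (Icc 0 T)) :=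
    hJ.aestronglyMeasurable_of_isCompact isCompact_Icc measurableSet_Icc
  obtain ⟨D, hD⟩ := isCompact_Icc.exists_bound_of_continuousOn hJ
  refine intervalIntegrable_of_bdd (C := K * D) ?_ (fun r hr => ?_) hs ht
  · exact (ContinuousLinearMap.compL ℝ E E F).aestronglyMeasurable_comp₂
      (hb.aestronglyMeasurable_fderiv hφ) hJm
  · exact (ContinuousLinearMap.opNorm_comp_le _ _).trans
      (mul_le_mul (hb.norm_fderiv_le r hr _) (hD r hr) (norm_nonneg _)
        ((norm_nonneg _).trans (hb.norm_fderiv_le r hr (φ r))))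

/-- Stability of solutions with respect to the initial value and the perturbation. -/
theorem IsSolution.norm_sub_le {b : ℝ → E → E} (hb : IsBddField T b C a) (ha : 0 ≤ a)
    {X Y : ℝ → E} {x y : E} {φ ψ : ℝ → E} (hφ : IsSolution T b X x φ)
    (hψ : IsSolution T b Y y ψ) {M : ℝ}
    (hM : ∀ t ∈ Icc (0:ℝ) T, ‖(x + X t) - (y + Y t)‖ ≤ M) :
    ∀ t ∈ Icc (0:ℝ) T, ‖φ t - ψ t‖ ≤ M * Real.exp (a * T) := by
  have h := norm_le_of_norm_le_integral (M := M) (N := 0) ha le_rfl (v := fun t => φ t - ψ t)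
    (f := fun r => b r (φ r) - b r (ψ r)) (hφ.1.sub hψ.1) (fun t ht => ?_)
    (fun r hr => by simpa using hb.norm_sub_le hr _ _)
  · simpa using h
  · have h0 : (0:ℝ) ∈ Icc (0:ℝ) T := ⟨le_rfl, ht.1.trans ht.2⟩
    rw [intervalIntegral.integral_sub (hb.intervalIntegrable hφ.1 h0 ht)
      (hb.intervalIntegrable hψ.1 h0 ht)]
    have e : φ t - ψ t = ((x + X t) - (y + Y t)) +
        ((∫ r in (0:ℝ)..t, b r (φ r)) - ∫ r in (0:ℝ)..t, b r (ψ r)) := by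
      rw [hφ.2 t ht, hψ.2 t ht]; abel
    rw [e]
    exact (norm_add_le _ _).trans (by gcongr; exact hM t ht)

theorem IsBddField.exists_isLinearizedSolution {b : ℝ → E → E} (hb : IsBddField T b C a)
    (ha : 0 ≤ a) {φ : ℝ → E} (hφ : ContinuousOn φ (Icc 0 T)) :
    ∃ J, IsLinearizedSolution T b φ J := by
  have := FiniteDimensional.complete ℝ E
  exact exists_linear_integral_eq ha (hb.aestronglyMeasurable_fderiv hφ)
    fun r hr => hb.norm_fderiv_le r hr _

/-- Second order estimate for the dependence of solutions on the initial value. -/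
theorem IsSolution.norm_sub_sub_le {b : ℝ → E → E} (hb : IsBddField T b C a) (ha : 0 ≤ a) {L : ℝ}
    (hL0 : 0 ≤ L) (hL : HasLipschitzFDeriv T b L) {X : ℝ → E} {x y : E} {φ ψ : ℝ → E}
    (hφ : IsSolution T b X x φ) (hψ : IsSolution T b X y ψ) {J : ℝ → E →L[ℝ] E}
    (hJ : IsLinearizedSolution T b φ J) :
    ∀ t ∈ Icc (0:ℝ) T, ‖ψ t - φ t - J t (y - x)‖ ≤
      L * (‖y - x‖ * Real.exp (a * T)) ^ 2 * T * Real.exp (a * T) := by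
  have := FiniteDimensional.complete ℝ E
  have hd := IsSolution.norm_sub_le hb ha hψ hφ (M := ‖y - x‖) (fun t _ => by simp)
  have h := norm_le_of_norm_le_integral (M := 0)
    (N := L * (‖y - x‖ * Real.exp (a * T)) ^ 2) ha (by positivity)
    (v := fun t => ψ t - φ t - J t (y - x))
    (f := fun r => b r (ψ r) - b r (φ r) - fderiv ℝ (b r) (φ r) (J r (y - x)))
    ((hψ.1.sub hφ.1).sub (hJ.1.clm_apply continuousOn_const)) (fun t ht => ?_)
    (fun r hr => ?_)
  · simpa using h
  · have h0 : (0:ℝ) ∈ Icc (0:ℝ) T := ⟨le_rfl, ht.1.trans ht.2⟩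
    have hi := hb.intervalIntegrable_fderiv_comp hφ.1 hJ.1 h0 ht
    have hi' : IntervalIntegrable (fun r => fderiv ℝ (b r) (φ r) (J r (y - x))) volume 0 t :=
      ⟨hi.1.apply_continuousLinearMap _, hi.2.apply_continuousLinearMap _⟩
    rw [zero_add, intervalIntegral.integral_sub ((hb.intervalIntegrable hψ.1 h0 ht).sub
      (hb.intervalIntegrable hφ.1 h0 ht)) hi',
      intervalIntegral.integral_sub (hb.intervalIntegrable hψ.1 h0 ht)
      (hb.intervalIntegrable hφ.1 h0 ht)]
    have e : J t (y - x) = (y - x) + ∫ r in (0:ℝ)..t, fderiv ℝ (b r) (φ r) (J r (y - x)) := by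
      rw [hJ.2 t ht, add_apply]
      congr 1
      exact ContinuousLinearMap.intervalIntegral_apply hi _
    rw [e, hφ.2 t ht, hψ.2 t ht]
    apply le_of_eq
    congr 1
    abel
  · refine (norm_sub_sub_fderiv_apply_le hL0 (hb.differentiable r hr) (hL r hr)
      (hb.norm_fderiv_le r hr) _ _ _).trans ?_
    gcongr
    exact hd r hr

/-- Differentiability with respect to the initial value of an integral functional of the flow. -/
theorem hasFDerivAt_integral_flow {b : ℝ → E → E} (hb : IsBddField T b C a) (ha : 0 ≤ a) {L : ℝ}
    (hL0 : 0 ≤ L) (hL : HasLipschitzFDeriv T b L) {c : ℝ → E → F} {m n l : ℝ}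
    (hc : IsBddField T c m n) (hn : 0 ≤ n) (hl0 : 0 ≤ l)
    (hl : HasLipschitzFDeriv T c l) {X : ℝ → E} {Φ : ℝ → E → E}
    (hΦ : ∀ y, IsSolution T b X y fun t => Φ t y) {x : E} {J : ℝ → E →L[ℝ] E}
    (hJ : IsLinearizedSolution T b (fun t => Φ t x) J) {t : ℝ} (ht : t ∈ Icc (0:ℝ) T) :
    HasFDerivAt (fun y => ∫ q in (0:ℝ)..t, c q (Φ q y))
      (∫ q in (0:ℝ)..t, (fderiv ℝ (c q) (Φ q x)).comp (J q)) x := by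
  have := FiniteDimensional.complete ℝ F
  have h0 : (0:ℝ) ∈ Icc (0:ℝ) T := ⟨le_rfl, ht.1.trans ht.2⟩
  refine hasFDerivAt_of_norm_le_sq (C := (n * (L * Real.exp (a * T) ^ 2 * T * Real.exp (a * T)) +
    l * Real.exp (a * T) ^ 2) * |t - 0|) fun y => ?_
  have hi := hc.intervalIntegrable_fderiv_comp (hΦ x).1 hJ.1 h0 ht
  have hi' : IntervalIntegrable (fun r => fderiv ℝ (c r) (Φ r x) (J r (y - x))) volume 0 t :=
    ⟨hi.1.apply_continuousLinearMap _, hi.2.apply_continuousLinearMap _⟩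
  have e : (∫ q in (0:ℝ)..t, (fderiv ℝ (c q) (Φ q x)).comp (J q)) (y - x) =
      ∫ r in (0:ℝ)..t, fderiv ℝ (c r) (Φ r x) (J r (y - x)) :=
    ContinuousLinearMap.intervalIntegral_apply hi _
  rw [e, ← intervalIntegral.integral_sub (hc.intervalIntegrable (hΦ y).1 h0 ht)
    (hc.intervalIntegrable (hΦ x).1 h0 ht), ← intervalIntegral.integral_sub
    ((hc.intervalIntegrable (hΦ y).1 h0 ht).sub (hc.intervalIntegrable (hΦ x).1 h0 ht)) hi']
  refine (norm_integral_le_of_bdd (C := (n * (L * (‖y - x‖ * Real.exp (a * T)) ^ 2 * T *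
    Real.exp (a * T)) + l * (‖y - x‖ * Real.exp (a * T)) ^ 2)) (fun r hr => ?_) h0 ht).trans
    (le_of_eq (by ring))
  refine (norm_sub_sub_fderiv_apply_le hl0 (hc.differentiable r hr) (hl r hr)
      (hc.norm_fderiv_le r hr) _ _ _).trans ?_
  gcongr
  · exact IsSolution.norm_sub_sub_le hb ha hL0 hL (hΦ x) (hΦ y) hJ r hr
  · exact IsSolution.norm_sub_le hb ha (hΦ y) (hΦ x) (M := ‖y - x‖) (fun t _ => by simp) r hr

/-- Stability of the linearized equation with respect to the base path. -/
theorem IsLinearizedSolution.norm_sub_le {b : ℝ → E → E} (hb : IsBddField T b C a) (ha : 0 ≤ a)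
    {L : ℝ} (hL0 : 0 ≤ L) (hL : HasLipschitzFDeriv T b L) {φ ψ : ℝ → E}
    (hφ : ContinuousOn φ (Icc 0 T)) (hψ : ContinuousOn ψ (Icc 0 T)) {δ : ℝ} (hδ0 : 0 ≤ δ)
    (hδ : ∀ t ∈ Icc (0:ℝ) T, ‖φ t - ψ t‖ ≤ δ) {J H : ℝ → E →L[ℝ] E}
    (hJ : IsLinearizedSolution T b φ J) (hH : IsLinearizedSolution T b ψ H) :
    ∀ t ∈ Icc (0:ℝ) T, ‖J t - H t‖ ≤ L * δ * Real.exp (a * T) * T * Real.exp (a * T) := by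
  have h := norm_le_of_norm_le_integral (M := 0) (N := L * δ * Real.exp (a * T)) ha (by positivity)
    (v := fun t => J t - H t)
    (f := fun r => fderiv ℝ (b r) (φ r) * J r - fderiv ℝ (b r) (ψ r) * H r) (hJ.1.sub hH.1)
    (fun t ht => ?_) (fun r hr => ?_)
  · simpa using h
  · have h0 : (0:ℝ) ∈ Icc (0:ℝ) T := ⟨le_rfl, ht.1.trans ht.2⟩
    have e := intervalIntegral.integral_sub (hb.intervalIntegrable_fderiv_comp hφ hJ.1 h0 ht)
      (hb.intervalIntegrable_fderiv_comp hψ hH.1 h0 ht)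
    rw [zero_add, hJ.2 t ht, hH.2 t ht, add_sub_add_left_eq_sub]
    exact (congrArg norm e).ge
  · exact norm_comp_sub_comp_le (hb.norm_fderiv_le r hr _)
      ((hL r hr _ _).trans (by gcongr; exact hδ r hr)) (hH.norm_le hb ha r hr)

end Fields

theorem norm_increment_integral_sub_le {F : Type*} [NormedAddCommGroup F] [NormedSpace ℝ F]
    {T ε : ℝ} {f g : ℝ → F}
    (hf : ∀ s ∈ Icc (0:ℝ) T, ∀ t ∈ Icc (0:ℝ) T, IntervalIntegrable f volume s t)
    (hg : ∀ s ∈ Icc (0:ℝ) T, ∀ t ∈ Icc (0:ℝ) T, IntervalIntegrable g volume s t)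
    (hfg : ∀ r ∈ Icc (0:ℝ) T, ‖f r - g r‖ ≤ ε) {s t : ℝ} (hs : s ∈ Icc (0:ℝ) T)
    (ht : t ∈ Icc (0:ℝ) T) :
    ‖((∫ r in (0:ℝ)..t, f r) - ∫ r in (0:ℝ)..t, g r) -
      ((∫ r in (0:ℝ)..s, f r) - ∫ r in (0:ℝ)..s, g r)‖ ≤ ε * |t - s| := by
  have h0 : (0:ℝ) ∈ Icc (0:ℝ) T := ⟨le_rfl, ht.1.trans ht.2⟩
  rw [← intervalIntegral.integral_sub (hf _ h0 _ ht) (hg _ h0 _ ht),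
    ← intervalIntegral.integral_sub (hf _ h0 _ hs) (hg _ h0 _ hs),
    intervalIntegral.integral_interval_sub_left ((hf _ h0 _ ht).sub (hg _ h0 _ ht))
      ((hf _ h0 _ hs).sub (hg _ h0 _ hs))]
  exact norm_integral_le_of_bdd hfg hs ht

theorem norm_increment_integral_le {F : Type*} [NormedAddCommGroup F] [NormedSpace ℝ F]
    {T C : ℝ} {f : ℝ → F}
    (hf : ∀ s ∈ Icc (0:ℝ) T, ∀ t ∈ Icc (0:ℝ) T, IntervalIntegrable f volume s t)
    (hC : ∀ r ∈ Icc (0:ℝ) T, ‖f r‖ ≤ C) {s t : ℝ} (hs : s ∈ Icc (0:ℝ) T)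
    (ht : t ∈ Icc (0:ℝ) T) :
    ‖(∫ r in (0:ℝ)..t, f r) - ∫ r in (0:ℝ)..s, f r‖ ≤ C * |t - s| := by
  have h0 : (0:ℝ) ∈ Icc (0:ℝ) T := ⟨le_rfl, ht.1.trans ht.2⟩
  rw [intervalIntegral.integral_interval_sub_left (hf _ h0 _ ht) (hf _ h0 _ hs)]
  exact norm_integral_le_of_bdd hC hs ht

theorem norm_integral_zero_le {F : Type*} [NormedAddCommGroup F] [NormedSpace ℝ F]
    {T C : ℝ} {f : ℝ → F} (hC : ∀ r ∈ Icc (0:ℝ) T, ‖f r‖ ≤ C) {t : ℝ} (ht : t ∈ Icc (0:ℝ) T) :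
    ‖∫ r in (0:ℝ)..t, f r‖ ≤ C * T := by
  have h0 : (0:ℝ) ∈ Icc (0:ℝ) T := ⟨le_rfl, ht.1.trans ht.2⟩
  have hC0 : 0 ≤ C := (norm_nonneg _).trans (hC 0 h0)
  refine (norm_integral_le_of_bdd hC h0 ht).trans ?_
  rw [sub_zero, abs_of_nonneg ht.1]
  exact mul_le_mul_of_nonneg_left ht.2 hC0

theorem abs_exp_sub_exp_le {R u v : ℝ} (hu : |u| ≤ R) (hv : |v| ≤ R) :
    |Real.exp u - Real.exp v| ≤ Real.exp R * |u - v| := by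
  have := (convex_Iic R).norm_image_sub_le_of_norm_deriv_le (f := Real.exp) (C := Real.exp R)
    (x := v) (y := u) (fun z _ => Real.differentiableAt_exp) (fun z hz => ?_)
    (abs_le.1 hv).2 (abs_le.1 hu).2
  · simpa using this
  · rw [Real.deriv_exp, Real.norm_of_nonneg (Real.exp_pos z).le]
    exact Real.exp_le_exp.2 hz

/-- Increments of a difference of exponentials. -/
theorem abs_increment_exp_sub_exp_le {R p q ε α α' β β' : ℝ} (hα : |α| ≤ R) (hα' : |α'| ≤ R)
    (hβ : |β| ≤ R) (hβ' : |β'| ≤ R) (hp : |α - α'| ≤ p) (hq : |α' - β'| ≤ q)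
    (hε : |(α - β) - (α' - β')| ≤ ε) :
    |(Real.exp α - Real.exp β) - (Real.exp α' - Real.exp β')| ≤
      Real.exp (3 * R) * (p * q + ε) := by
  have hR : 0 ≤ R := (abs_nonneg _).trans hα
  have hq0 : 0 ≤ q := (abs_nonneg _).trans hq
  have e : (Real.exp α - Real.exp β) - (Real.exp α' - Real.exp β') =
      (Real.exp α' - Real.exp β') * (Real.exp (α - α') - Real.exp 0) +
        Real.exp β' * (Real.exp (α - α') - Real.exp (β - β')) := by
    simp only [Real.exp_sub, Real.exp_zero]
    field_simp
    ring
  have h1 : |α - α'| ≤ 2 * R := by have := abs_sub α α'; linarith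
  have h2 : |β - β'| ≤ 2 * R := by have := abs_sub β β'; linarith
  have e3 : Real.exp (3 * R) = Real.exp R * Real.exp (2 * R) := by rw [← Real.exp_add]; ring_nf
  rw [e]
  refine (abs_add_le _ _).trans ?_
  rw [abs_mul, abs_mul, Real.abs_exp, mul_add, e3]
  have i1 : |Real.exp α' - Real.exp β'| ≤ Real.exp R * q :=
    (abs_exp_sub_exp_le hα' hβ').trans (by gcongr)
  have i2 : |Real.exp (α - α') - Real.exp 0| ≤ Real.exp (2 * R) * p :=
    (abs_exp_sub_exp_le h1 (by simpa using hR)).trans (by rw [sub_zero]; gcongr)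
  have i3 : |Real.exp (α - α') - Real.exp (β - β')| ≤ Real.exp (2 * R) * ε :=
    (abs_exp_sub_exp_le h1 h2).trans (by
      gcongr
      rwa [show α - α' - (β - β') = (α - β) - (α' - β') by ring])
  have i4 : Real.exp β' ≤ Real.exp R := Real.exp_le_exp.2 (abs_le.1 hβ').2
  calc _ ≤ (Real.exp R * q) * (Real.exp (2 * R) * p) + Real.exp R * (Real.exp (2 * R) * ε) := by
        gcongr
    _ = _ := by ring

theorem norm_increment_smul_sub_le {V : Type*} [NormedAddCommGroup V] [NormedSpace ℝ V]
    {k₁ k₂ k₃ k₄ l₁ l₂ l₃ l₄ p q p' q' : ℝ} {u v u' v' : V}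
    (h₁ : |(p - q) - (p' - q')| ≤ k₁) (h₂ : |p' - q'| ≤ k₂) (h₃ : |q| ≤ k₃) (h₄ : |q - q'| ≤ k₄)
    (i₁ : ‖u‖ ≤ l₁) (i₂ : ‖u - u'‖ ≤ l₂) (i₃ : ‖(u - v) - (u' - v')‖ ≤ l₃)
    (i₄ : ‖u' - v'‖ ≤ l₄) :
    ‖(p • u - q • v) - (p' • u' - q' • v')‖ ≤ k₁ * l₁ + k₂ * l₂ + k₃ * l₃ + k₄ * l₄ := by
  have e : (p • u - q • v) - (p' • u' - q' • v') = ((p - q) - (p' - q')) • u +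
      (p' - q') • (u - u') + q • ((u - v) - (u' - v')) + (q - q') • (u' - v') := by
    module
  have hs : ∀ {k l r : ℝ} {w : V}, |r| ≤ k → ‖w‖ ≤ l → ‖r • w‖ ≤ k * l := fun {k l r w} h i => by
    rw [norm_smul, Real.norm_eq_abs]
    exact mul_le_mul h i (norm_nonneg _) ((abs_nonneg _).trans h)
  rw [e]
  exact (norm_add₄_le).trans (add_le_add (add_le_add (add_le_add (hs h₁ i₁) (hs h₂ i₂))
    (hs h₃ i₃)) (hs h₄ i₄))

section Weights

variable {E : Type*} [NormedAddCommGroup E] [NormedSpace ℝ E] [MeasurableSpace E] [BorelSpace E]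
  {T m n δ : ℝ}

/-- Exponential weights along two nearby paths: the increments of their difference. -/
theorem abs_increment_weight_sub_le {c : ℝ → E → ℝ} (hc : IsBddField T c m n) (hn : 0 ≤ n)
    {φ ψ : ℝ → E} (hφ : ContinuousOn φ (Icc 0 T)) (hψ : ContinuousOn ψ (Icc 0 T))
    (hδ : ∀ r ∈ Icc (0:ℝ) T, ‖φ r - ψ r‖ ≤ δ) {s t : ℝ} (hs : s ∈ Icc (0:ℝ) T)
    (ht : t ∈ Icc (0:ℝ) T) :
    |(Real.exp (∫ q in (0:ℝ)..t, c q (φ q)) - Real.exp (∫ q in (0:ℝ)..t, c q (ψ q))) -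
      (Real.exp (∫ q in (0:ℝ)..s, c q (φ q)) - Real.exp (∫ q in (0:ℝ)..s, c q (ψ q)))| ≤
      Real.exp (3 * (m * T)) * (m * (n * δ * T) + n * δ) * |t - s| := by
  have h0 : (0:ℝ) ∈ Icc (0:ℝ) T := ⟨le_rfl, ht.1.trans ht.2⟩
  have iφ := fun s hs t ht => hc.intervalIntegrable hφ (s := s) (t := t) hs ht
  have iψ := fun s hs t ht => hc.intervalIntegrable hψ (s := s) (t := t) hs ht
  have hcd : ∀ r ∈ Icc (0:ℝ) T, ‖c r (φ r) - c r (ψ r)‖ ≤ n * δ := fun r hr =>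
    (hc.norm_sub_le hr _ _).trans (by gcongr; exact hδ r hr)
  have hb : ∀ {χ : ℝ → E}, ∀ t ∈ Icc (0:ℝ) T, |∫ q in (0:ℝ)..t, c q (χ q)| ≤ m * T :=
    fun t ht => norm_integral_zero_le (fun r hr => hc.norm_le r hr _) ht
  refine (abs_increment_exp_sub_exp_le (hb t ht) (hb s hs) (hb t ht) (hb s hs)
    (norm_increment_integral_le iφ (fun r hr => hc.norm_le r hr _) hs ht) (q := n * δ * T) ?_
    (norm_increment_integral_sub_le iφ iψ hcd hs ht)).trans (le_of_eq (by ring))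
  rw [← intervalIntegral.integral_sub (iφ _ h0 _ hs) (iψ _ h0 _ hs)]
  exact norm_integral_zero_le hcd hs

/-- Gradients of exponential weights along two nearby flows: the increments of their difference. -/
theorem norm_increment_fderiv_weight_sub_le [FiniteDimensional ℝ E] {b : ℝ → E → E} {C a : ℝ}
    (hb : IsBddField T b C a) (ha : 0 ≤ a) {L : ℝ} (hL0 : 0 ≤ L)
    (hL : HasLipschitzFDeriv T b L) {c : ℝ → E → ℝ} {l : ℝ} (hc : IsBddField T c m n)
    (hn : 0 ≤ n) (hl0 : 0 ≤ l) (hl : HasLipschitzFDeriv T c l) {X Y : ℝ → E}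
    {Φ Ψ : ℝ → E → E} (hΦ : ∀ y, IsSolution T b X y fun t => Φ t y)
    (hΨ : ∀ y, IsSolution T b Y y fun t => Ψ t y) (hδ0 : 0 ≤ δ) {x : E}
    (hδ : ∀ r ∈ Icc (0:ℝ) T, ‖Φ r x - Ψ r x‖ ≤ δ) {s t : ℝ} (hs : s ∈ Icc (0:ℝ) T)
    (ht : t ∈ Icc (0:ℝ) T) :
    ‖(fderiv ℝ (fun y => Real.exp (∫ q in (0:ℝ)..t, c q (Φ q y))) x -
        fderiv ℝ (fun y => Real.exp (∫ q in (0:ℝ)..t, c q (Ψ q y))) x) -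
      (fderiv ℝ (fun y => Real.exp (∫ q in (0:ℝ)..s, c q (Φ q y))) x -
        fderiv ℝ (fun y => Real.exp (∫ q in (0:ℝ)..s, c q (Ψ q y))) x)‖ ≤
      (Real.exp (3 * (m * T)) * (m * (n * δ * T) + n * δ) * (n * Real.exp (a * T) * T) +
        Real.exp (m * T) * (n * δ * T) * (n * Real.exp (a * T)) +
        Real.exp (m * T) * (1 + m * T) *
          (n * (L * δ * Real.exp (a * T) * T * Real.exp (a * T)) +
            l * δ * Real.exp (a * T))) * |t - s| := by
  have h0 : (0:ℝ) ∈ Icc (0:ℝ) T := ⟨le_rfl, ht.1.trans ht.2⟩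
  obtain ⟨J, hJ⟩ := hb.exists_isLinearizedSolution ha (hΦ x).1
  obtain ⟨H, hH⟩ := hb.exists_isLinearizedSolution ha (hΨ x).1
  rw [(hasFDerivAt_integral_flow hb ha hL0 hL hc hn hl0 hl hΦ hJ ht).exp.fderiv,
    (hasFDerivAt_integral_flow hb ha hL0 hL hc hn hl0 hl hΨ hH ht).exp.fderiv,
    (hasFDerivAt_integral_flow hb ha hL0 hL hc hn hl0 hl hΦ hJ hs).exp.fderiv,
    (hasFDerivAt_integral_flow hb ha hL0 hL hc hn hl0 hl hΨ hH hs).exp.fderiv]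
  have iφ := fun s hs t ht => hc.intervalIntegrable (hΦ x).1 (s := s) (t := t) hs ht
  have iψ := fun s hs t ht => hc.intervalIntegrable (hΨ x).1 (s := s) (t := t) hs ht
  have iJ := fun s hs t ht =>
    hc.intervalIntegrable_fderiv_comp (hΦ x).1 hJ.1 (s := s) (t := t) hs ht
  have iH := fun s hs t ht =>
    hc.intervalIntegrable_fderiv_comp (hΨ x).1 hH.1 (s := s) (t := t) hs ht
  have hcd : ∀ r ∈ Icc (0:ℝ) T, ‖c r (Φ r x) - c r (Ψ r x)‖ ≤ n * δ := fun r hr =>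
    (hc.norm_sub_le hr _ _).trans (by gcongr; exact hδ r hr)
  have hbd : ∀ {χ : ℝ → E}, ∀ t ∈ Icc (0:ℝ) T, |∫ q in (0:ℝ)..t, c q (χ q)| ≤ m * T :=
    fun t ht => norm_integral_zero_le (fun r hr => hc.norm_le r hr _) ht
  have hJb : ∀ r ∈ Icc (0:ℝ) T,
      ‖(fderiv ℝ (c r) (Φ r x)).comp (J r)‖ ≤ n * Real.exp (a * T) := fun r hr =>
    (ContinuousLinearMap.opNorm_comp_le _ _).trans
      (mul_le_mul (hc.norm_fderiv_le r hr _) (hJ.norm_le hb ha r hr) (norm_nonneg _) hn)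
  have hJH : ∀ r ∈ Icc (0:ℝ) T,
      ‖(fderiv ℝ (c r) (Φ r x)).comp (J r) - (fderiv ℝ (c r) (Ψ r x)).comp (H r)‖ ≤
        n * (L * δ * Real.exp (a * T) * T * Real.exp (a * T)) + l * δ * Real.exp (a * T) :=
    fun r hr => (norm_comp_sub_comp_le (hc.norm_fderiv_le r hr _)
      ((hl r hr _ _).trans (mul_le_mul_of_nonneg_left (hδ r hr) hl0))
      (hH.norm_le hb ha r hr)).trans (by
        gcongr
        exact hJ.norm_sub_le hb ha hL0 hL (hΦ x).1 (hΨ x).1 hδ0 hδ hH r hr)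
  refine (norm_increment_smul_sub_le
    (abs_increment_weight_sub_le hc hn (hΦ x).1 (hΨ x).1 hδ hs ht)
    (k₂ := Real.exp (m * T) * (n * δ * T)) ?_ (k₃ := Real.exp (m * T)) ?_
    (k₄ := Real.exp (m * T) * (m * |t - s|)) ?_
    (norm_integral_zero_le hJb ht) (norm_increment_integral_le iJ hJb hs ht)
    (norm_increment_integral_sub_le iJ iH hJH hs ht)
    (l₄ := (n * (L * δ * Real.exp (a * T) * T * Real.exp (a * T)) + l * δ * Real.exp (a * T)) * T)
    ?_).trans (le_of_eq (by ring))
  · refine (abs_exp_sub_exp_le (hbd s hs) (hbd s hs)).trans ?_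
    gcongr
    rw [← intervalIntegral.integral_sub (iφ _ h0 _ hs) (iψ _ h0 _ hs)]
    exact norm_integral_zero_le hcd hs
  · rw [Real.abs_exp]
    exact Real.exp_le_exp.2 (abs_le.1 (hbd t ht)).2
  · refine (abs_exp_sub_exp_le (hbd t ht) (hbd s hs)).trans ?_
    gcongr
    exact norm_increment_integral_le iψ (fun r hr => hc.norm_le r hr _) hs ht
  · rw [← intervalIntegral.integral_sub (iJ _ h0 _ hs) (iH _ h0 _ hs)]
    exact norm_integral_zero_le hJH hs

end Weights

/-- The constant in the bound on the exponential weights. -/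
def weightConst (T a m n : ℝ) : ℝ :=
  Real.exp (3 * (m * T)) * (m * (n * ((1 + T) * Real.exp (a * T)) * T) +
    n * ((1 + T) * Real.exp (a * T)))

/-- The constant in the bound on the gradients of the exponential weights. -/
def gradConst (T a k m n l : ℝ) : ℝ :=
  weightConst T a m n * (n * Real.exp (a * T) * T) +
    Real.exp (m * T) * (n * ((1 + T) * Real.exp (a * T)) * T) * (n * Real.exp (a * T)) +
    Real.exp (m * T) * (1 + m * T) *
      (n * (k * ((1 + T) * Real.exp (a * T)) * Real.exp (a * T) * T * Real.exp (a * T)) +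
        l * ((1 + T) * Real.exp (a * T)) * Real.exp (a * T))

theorem weightConst_nonneg {T a m n : ℝ} (hT : 0 ≤ T) (hm : 0 ≤ m) (hn : 0 ≤ n) :
    0 ≤ weightConst T a m n := by
  unfold weightConst; positivity

theorem weightConst_mono {T a m n T' a' m' n' : ℝ} (hT : 0 ≤ T) (ha : 0 ≤ a) (hm : 0 ≤ m)
    (hn : 0 ≤ n) (hT' : T ≤ T') (ha' : a ≤ a') (hm' : m ≤ m') (hn' : n ≤ n') :
    weightConst T a m n ≤ weightConst T' a' m' n' := by
  have := hT.trans hT'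
  have := ha.trans ha'
  have := hm.trans hm'
  have := hn.trans hn'
  unfold weightConst
  gcongr

theorem gradConst_nonneg {T a k m n l : ℝ} (hT : 0 ≤ T) (hk : 0 ≤ k) (hm : 0 ≤ m) (hn : 0 ≤ n)
    (hl : 0 ≤ l) : 0 ≤ gradConst T a k m n l := by
  have := weightConst_nonneg (a := a) hT hm hn
  unfold gradConst; positivity

theorem gradConst_mono {T a k m n l T' a' k' m' n' l' : ℝ} (hT : 0 ≤ T) (ha : 0 ≤ a) (hk : 0 ≤ k)
    (hm : 0 ≤ m) (hn : 0 ≤ n) (hl : 0 ≤ l) (hT' : T ≤ T') (ha' : a ≤ a') (hk' : k ≤ k')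
    (hm' : m ≤ m') (hn' : n ≤ n') (hl' : l ≤ l') :
    gradConst T a k m n l ≤ gradConst T' a' k' m' n' l' := by
  have := hT.trans hT'
  have := ha.trans ha'
  have := hk.trans hk'
  have := hm.trans hm'
  have := hn.trans hn'
  have := hl.trans hl'
  have h := weightConst_mono hT ha hm hn hT' ha' hm' hn'
  have h0 := weightConst_nonneg (a := a) hT hm hn
  have h0' := h0.trans h
  unfold gradConst
  gcongr

theorem norm_gradient_eq_norm_fderiv {E : Type*} [NormedAddCommGroup E] [InnerProductSpace ℝ E]
    [CompleteSpace E] (f : E → ℝ) (x : E) : ‖gradient f x‖ = ‖fderiv ℝ f x‖ :=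
  LinearIsometryEquiv.norm_map _ _

/-- A Hölder bound controls the supremum of a path started at the origin. -/
theorem norm_sub_le_of_holder {E : Type*} [NormedAddCommGroup E] {γ T D : ℝ} (hγ0 : 0 < γ)
    (hγ1 : γ ≤ 1) (hD : 0 ≤ D) {X Y : ℝ → E} (hX : X 0 = 0) (hY : Y 0 = 0)
    (h : ∀ s ∈ Icc (0:ℝ) T, ∀ t ∈ Icc (0:ℝ) T,
      ‖(X t - Y t) - (X s - Y s)‖ ≤ D * |t - s| ^ γ) :
    ∀ t ∈ Icc (0:ℝ) T, ‖X t - Y t‖ ≤ D * (1 + T) := by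
  intro t ht
  have h0 : (0:ℝ) ∈ Icc (0:ℝ) T := ⟨le_rfl, ht.1.trans ht.2⟩
  have := h 0 h0 t ht
  rw [hX, hY, sub_self, sub_zero, sub_zero, abs_of_nonneg ht.1] at this
  refine this.trans (mul_le_mul_of_nonneg_left ?_ hD)
  calc t ^ γ ≤ (1 + T) ^ γ := Real.rpow_le_rpow ht.1 (by linarith [ht.2]) hγ0.le
    _ ≤ (1 + T) ^ (1:ℝ) := Real.rpow_le_rpow_of_exponent_le (by linarith [h0.2]) hγ1
    _ = 1 + T := Real.rpow_one _

theorem nonneg_of_holder {E : Type*} [NormedAddCommGroup E] {γ T D : ℝ} (hT : 0 < T) {Z : ℝ → E}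
    (h : ∀ s ∈ Icc (0:ℝ) T, ∀ t ∈ Icc (0:ℝ) T, ‖Z t - Z s‖ ≤ D * |t - s| ^ γ) : 0 ≤ D := by
  have := (norm_nonneg _).trans (h 0 ⟨le_rfl, hT.le⟩ T ⟨hT.le, le_rfl⟩)
  rw [sub_zero, abs_of_pos hT] at this
  exact nonneg_of_mul_nonneg_left this (Real.rpow_pos_of_pos hT γ)

/-- comparison of exponential weights along the two flows, Lemma
`convergence_jacobien_smooth`. With `K^X_t(x) = exp(∫_0^t c_q(Φ^X_q(x)) dq)` and
`K^Y` defined with the flow driven by `Y`, (i) the difference `K^X(x) - K^Y(x)` is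
Lipschitz in time with constant `C(T,‖Db‖,‖c‖,‖∇c‖) ‖X-Y‖_γ` (and `K^X_0 = K^Y_0 = 1`);
(ii) if moreover `b, c ∈ L^∞([0,T];C²_b)` then the spatial gradients satisfy the same
kind of bound with a constant depending additionally on `‖D²b‖` and `‖D²c‖`. -/
theorem stmt15 (d : ℕ) (γ : ℝ) (hγ0 : 0 < γ) (hγ1 : γ ≤ 1) :
    (∃ C : ℝ → ℝ → ℝ → ℝ → ℝ,
      (∀ a₁ a₂ b₁ b₂ c₁ c₂ d₁ d₂ : ℝ, a₁ ≤ a₂ → b₁ ≤ b₂ → c₁ ≤ c₂ → d₁ ≤ d₂ →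
        C a₁ b₁ c₁ d₁ ≤ C a₂ b₂ c₂ d₂) ∧
      ∀ (T CDb Cc CDc : ℝ), 0 < T →
      ∀ (b : ℝ → Euc d → Euc d) (c : ℝ → Euc d → ℝ) (X Y : ℝ → Euc d)
        (ΦX ΦY : ℝ → Euc d → Euc d) (CXY : ℝ),
        Measurable (Function.uncurry b) →
        (∀ t ∈ Icc (0:ℝ) T, ContDiff ℝ 1 (b t)) →
        (∃ Cb : ℝ, ∀ t ∈ Icc (0:ℝ) T, ∀ x : Euc d, ‖b t x‖ ≤ Cb) →
        (∀ t ∈ Icc (0:ℝ) T, ∀ x : Euc d, ‖fderiv ℝ (b t) x‖ ≤ CDb) →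
        Measurable (Function.uncurry c) →
        (∀ t ∈ Icc (0:ℝ) T, ContDiff ℝ 1 (c t)) →
        (∀ t ∈ Icc (0:ℝ) T, ∀ x : Euc d, |c t x| ≤ Cc) →
        (∀ t ∈ Icc (0:ℝ) T, ∀ x : Euc d, ‖gradient (c t) x‖ ≤ CDc) →
        X 0 = 0 → Y 0 = 0 →
        (∃ CX : ℝ, ∀ s ∈ Icc (0:ℝ) T, ∀ t ∈ Icc (0:ℝ) T,
          ‖X t - X s‖ ≤ CX * |t - s| ^ γ) →
        (∃ CY : ℝ, ∀ s ∈ Icc (0:ℝ) T, ∀ t ∈ Icc (0:ℝ) T,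
          ‖Y t - Y s‖ ≤ CY * |t - s| ^ γ) →
        (∀ s ∈ Icc (0:ℝ) T, ∀ t ∈ Icc (0:ℝ) T,
          ‖(X t - Y t) - (X s - Y s)‖ ≤ CXY * |t - s| ^ γ) →
        (∀ x : Euc d, ContinuousOn (fun t => ΦX t x) (Icc (0:ℝ) T)) →
        (∀ x : Euc d, ∀ t ∈ Icc (0:ℝ) T,
          ΦX t x = x + (∫ r in (0:ℝ)..t, b r (ΦX r x)) + X t) →
        (∀ x : Euc d, ContinuousOn (fun t => ΦY t x) (Icc (0:ℝ) T)) →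
        (∀ x : Euc d, ∀ t ∈ Icc (0:ℝ) T,
          ΦY t x = x + (∫ r in (0:ℝ)..t, b r (ΦY r x)) + Y t) →
        ∀ x : Euc d,
          (Real.exp (∫ q in (0:ℝ)..(0:ℝ), c q (ΦX q x)) = 1 ∧
            Real.exp (∫ q in (0:ℝ)..(0:ℝ), c q (ΦY q x)) = 1) ∧
          ∀ s ∈ Icc (0:ℝ) T, ∀ t ∈ Icc (0:ℝ) T, s ≠ t →
            |(Real.exp (∫ q in (0:ℝ)..t, c q (ΦX q x)) -
                Real.exp (∫ q in (0:ℝ)..t, c q (ΦY q x))) -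
              (Real.exp (∫ q in (0:ℝ)..s, c q (ΦX q x)) -
                Real.exp (∫ q in (0:ℝ)..s, c q (ΦY q x)))| ≤
              C T CDb Cc CDc * CXY * |t - s|) ∧
    (∃ C' : ℝ → ℝ → ℝ → ℝ → ℝ → ℝ → ℝ,
      (∀ a₁ a₂ b₁ b₂ c₁ c₂ d₁ d₂ e₁ e₂ f₁ f₂ : ℝ,
        a₁ ≤ a₂ → b₁ ≤ b₂ → c₁ ≤ c₂ → d₁ ≤ d₂ → e₁ ≤ e₂ → f₁ ≤ f₂ →
        C' a₁ b₁ c₁ d₁ e₁ f₁ ≤ C' a₂ b₂ c₂ d₂ e₂ f₂) ∧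
      ∀ (T CDb C2Db Cc CDc C2Dc : ℝ), 0 < T →
      ∀ (b : ℝ → Euc d → Euc d) (c : ℝ → Euc d → ℝ) (X Y : ℝ → Euc d)
        (ΦX ΦY : ℝ → Euc d → Euc d) (CXY : ℝ),
        Measurable (Function.uncurry b) →
        (∀ t ∈ Icc (0:ℝ) T, ContDiff ℝ 2 (b t)) →
        (∃ Cb : ℝ, ∀ t ∈ Icc (0:ℝ) T, ∀ x : Euc d, ‖b t x‖ ≤ Cb) →
        (∀ t ∈ Icc (0:ℝ) T, ∀ x : Euc d, ‖fderiv ℝ (b t) x‖ ≤ CDb) →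
        (∀ t ∈ Icc (0:ℝ) T, ∀ x : Euc d, ‖iteratedFDeriv ℝ 2 (b t) x‖ ≤ C2Db) →
        Measurable (Function.uncurry c) →
        (∀ t ∈ Icc (0:ℝ) T, ContDiff ℝ 2 (c t)) →
        (∀ t ∈ Icc (0:ℝ) T, ∀ x : Euc d, |c t x| ≤ Cc) →
        (∀ t ∈ Icc (0:ℝ) T, ∀ x : Euc d, ‖gradient (c t) x‖ ≤ CDc) →
        (∀ t ∈ Icc (0:ℝ) T, ∀ x : Euc d, ‖iteratedFDeriv ℝ 2 (c t) x‖ ≤ C2Dc) →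
        X 0 = 0 → Y 0 = 0 →
        (∃ CX : ℝ, ∀ s ∈ Icc (0:ℝ) T, ∀ t ∈ Icc (0:ℝ) T,
          ‖X t - X s‖ ≤ CX * |t - s| ^ γ) →
        (∃ CY : ℝ, ∀ s ∈ Icc (0:ℝ) T, ∀ t ∈ Icc (0:ℝ) T,
          ‖Y t - Y s‖ ≤ CY * |t - s| ^ γ) →
        (∀ s ∈ Icc (0:ℝ) T, ∀ t ∈ Icc (0:ℝ) T,
          ‖(X t - Y t) - (X s - Y s)‖ ≤ CXY * |t - s| ^ γ) →
        (∀ x : Euc d, ContinuousOn (fun t => ΦX t x) (Icc (0:ℝ) T)) →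
        (∀ x : Euc d, ∀ t ∈ Icc (0:ℝ) T,
          ΦX t x = x + (∫ r in (0:ℝ)..t, b r (ΦX r x)) + X t) →
        (∀ x : Euc d, ContinuousOn (fun t => ΦY t x) (Icc (0:ℝ) T)) →
        (∀ x : Euc d, ∀ t ∈ Icc (0:ℝ) T,
          ΦY t x = x + (∫ r in (0:ℝ)..t, b r (ΦY r x)) + Y t) →
        ∀ x : Euc d,
          let GX : ℝ → Euc d := fun t =>
            gradient (fun y => Real.exp (∫ q in (0:ℝ)..t, c q (ΦX q y))) x
          let GY : ℝ → Euc d := fun t =>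
            gradient (fun y => Real.exp (∫ q in (0:ℝ)..t, c q (ΦY q y))) x
          (∀ s ∈ Icc (0:ℝ) T, ∀ t ∈ Icc (0:ℝ) T, s ≠ t →
            ‖(GX t - GY t) - (GX s - GY s)‖ ≤
              C' T CDb C2Db Cc CDc C2Dc * CXY * |t - s|) ∧
          ‖GX 0 - GY 0‖ ≤ C' T CDb C2Db Cc CDc C2Dc * CXY) := by
  have hmax : ∀ {u v : ℝ}, u ≤ v → max u 0 ≤ max v 0 := fun h => max_le_max_right 0 h
  have h0 : ∀ u : ℝ, 0 ≤ max u 0 := fun u => le_max_right u 0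
  refine ⟨⟨fun T a m n => weightConst (max T 0) (max a 0) (max m 0) (max n 0), ?_, ?_⟩,
    ⟨fun T a k m n l =>
      gradConst (max T 0) (max a 0) (max k 0) (max m 0) (max n 0) (max l 0), ?_, ?_⟩⟩
  · intro a₁ a₂ b₁ b₂ c₁ c₂ d₁ d₂ ha hb hc hd
    exact weightConst_mono (h0 _) (h0 _) (h0 _) (h0 _) (hmax ha) (hmax hb) (hmax hc) (hmax hd)
  · intro T a m n hT b c X Y ΦX ΦY D hbm hbd hbb hbK hcm hcd hcb hcK hX0 hY0 _ _ hXY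
      hΦXc hΦX hΦYc hΦY x
    refine ⟨by simp, fun s hs t ht _ => ?_⟩
    have h0T : (0:ℝ) ∈ Icc (0:ℝ) T := ⟨le_rfl, hT.le⟩
    obtain ⟨Cb, hCb⟩ := hbb
    have ha : 0 ≤ a := (norm_nonneg _).trans (hbK 0 h0T 0)
    have hm : 0 ≤ m := (abs_nonneg _).trans (hcb 0 h0T 0)
    have hn : 0 ≤ n := (norm_nonneg _).trans (hcK 0 h0T 0)
    have hD : 0 ≤ D := nonneg_of_holder hT hXY
    have hb : IsBddField T b Cb a :=
      ⟨hbm, fun t ht => (hbd t ht).differentiable one_ne_zero, hCb, hbK⟩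
    have hc : IsBddField T c m n :=
      ⟨hcm, fun t ht => (hcd t ht).differentiable one_ne_zero, hcb,
        fun t ht x => (norm_gradient_eq_norm_fderiv (c t) x).ge.trans (hcK t ht x)⟩
    have hδ := IsSolution.norm_sub_le hb ha ⟨hΦXc x, hΦX x⟩ ⟨hΦYc x, hΦY x⟩
      (M := D * (1 + T)) (fun t ht => by
        simpa using norm_sub_le_of_holder hγ0 hγ1 hD hX0 hY0 hXY t ht)
    refine (abs_increment_weight_sub_le hc hn (hΦXc x) (hΦYc x) hδ hs ht).trans (le_of_eq ?_)
    simp only [max_eq_left hT.le, max_eq_left ha, max_eq_left hm, max_eq_left hn, weightConst]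
    ring
  · intro a₁ a₂ b₁ b₂ c₁ c₂ d₁ d₂ e₁ e₂ f₁ f₂ ha hb hc hd he hf
    exact gradConst_mono (h0 _) (h0 _) (h0 _) (h0 _) (h0 _) (h0 _) (hmax ha) (hmax hb) (hmax hc)
      (hmax hd) (hmax he) (hmax hf)
  · intro T a k m n l hT b c X Y ΦX ΦY D hbm hbd hbb hbK hbL hcm hcd hcb hcK hcL hX0 hY0 _ _ hXY
      hΦXc hΦX hΦYc hΦY x GX GY
    have h0T : (0:ℝ) ∈ Icc (0:ℝ) T := ⟨le_rfl, hT.le⟩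
    obtain ⟨Cb, hCb⟩ := hbb
    have ha : 0 ≤ a := (norm_nonneg _).trans (hbK 0 h0T 0)
    have hk : 0 ≤ k := (norm_nonneg _).trans (hbL 0 h0T 0)
    have hm : 0 ≤ m := (abs_nonneg _).trans (hcb 0 h0T 0)
    have hn : 0 ≤ n := (norm_nonneg _).trans (hcK 0 h0T 0)
    have hl : 0 ≤ l := (norm_nonneg _).trans (hcL 0 h0T 0)
    have hD : 0 ≤ D := nonneg_of_holder hT hXY
    have hb : IsBddField T b Cb a :=
      ⟨hbm, fun t ht => (hbd t ht).differentiable two_ne_zero, hCb, hbK⟩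
    have hc : IsBddField T c m n :=
      ⟨hcm, fun t ht => (hcd t ht).differentiable two_ne_zero, hcb,
        fun t ht x => (norm_gradient_eq_norm_fderiv (c t) x).ge.trans (hcK t ht x)⟩
    have hbL' : HasLipschitzFDeriv T b k := fun t ht =>
      norm_fderiv_sub_le_of_iteratedFDeriv_bound (hbd t ht) (hbL t ht)
    have hcL' : HasLipschitzFDeriv T c l := fun t ht =>
      norm_fderiv_sub_le_of_iteratedFDeriv_bound (hcd t ht) (hcL t ht)
    have hδ := IsSolution.norm_sub_le hb ha ⟨hΦXc x, hΦX x⟩ ⟨hΦYc x, hΦY x⟩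
      (M := D * (1 + T)) (fun t ht => by
        simpa using norm_sub_le_of_holder hγ0 hγ1 hD hX0 hY0 hXY t ht)
    refine ⟨fun s hs t ht _ => ?_, ?_⟩
    · simp only [GX, GY, gradient, ← map_sub, LinearIsometryEquiv.norm_map]
      refine (norm_increment_fderiv_weight_sub_le hb ha hk hbL' hc hn hl hcL'
        (fun y => ⟨hΦXc y, hΦX y⟩) (fun y => ⟨hΦYc y, hΦY y⟩) (by positivity) hδ hs ht).trans
        (le_of_eq ?_)
      simp only [max_eq_left hT.le, max_eq_left ha, max_eq_left hk, max_eq_left hm,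
        max_eq_left hn, max_eq_left hl, gradConst, weightConst]
      ring
    · simp only [GX, GY, intervalIntegral.integral_same, sub_self, norm_zero]
      exact mul_nonneg (gradConst_nonneg (h0 _) (h0 _) (h0 _) (h0 _) (h0 _)) hD
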